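/- arXiv:1702.00672 — 3 statements merged into one kernel-verified Lean document; each statement's English description precedes it below -/
import Mathlib

section
/- Let 0 < V ≤ 1. For every MUB pair on the qubit, the colored-noise BB84 family box P_col^V admits no extremal LHV-LHS model. -/
open Matrix Complex BigOperators
open scoped ComplexOrder

noncomputable section

abbrev Vec : Type := Fin 2 → ℂ
abbrev Mat : Type := Matrix (Fin 2) (Fin 2) ℂ

/-- Inner product ⟨v, w⟩ on ℂ², conjugate-linear in the first argument. -/
def inn (v w : Vec) : ℂ := star v ⬝ᵥ w

/-- A pair of mutually unbiased orthonormal bases of ℂ²: `e 0 = {f₀,f₁}` and `e 1 = {g₀,g₁}`. -/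
def IsMUBPair (e : Fin 2 → Fin 2 → Vec) : Prop :=
  (∀ y i j, inn (e y i) (e y j) = if i = j then 1 else 0) ∧
  (∀ i j, Complex.normSq (inn (e 0 i) (e 1 j)) = 1 / 2)

/-- The colored-noise BB84 family box. -/
def Pcol (V : ℝ) (a b x y : Fin 2) : ℝ :=
  (1 + (-1 : ℝ) ^ ((a + b + x * y : Fin 2) : ℕ) *
        ((if x = y then V else 0) + (1 - V) / 2)
     + (-1 : ℝ) ^ ((a + b + x + y : Fin 2) : ℕ) * ((1 - V) / 2)) / 4

/-- A box admits an extremal LHV-LHS model: a convex mixture of products of Alice's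
deterministic response functions with Bob's pure-state quantum distributions in the MUBs. -/
def HasExtremalLHVLHS (e : Fin 2 → Fin 2 → Vec)
    (P : Fin 2 → Fin 2 → Fin 2 → Fin 2 → ℝ) : Prop :=
  ∃ (n : ℕ) (p : Fin n → ℝ) (A : Fin 2 → Fin n → Fin 2) (ψ : Fin n → Vec),
    (∀ l, 0 ≤ p l) ∧ (∑ l, p l = 1) ∧
    (∀ l, inn (ψ l) (ψ l) = 1) ∧
    (∀ a b x y, P a b x y =
      ∑ l, p l * (if a = A x l then 1 else 0) * Complex.normSq (inn (e y b) (ψ l)))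

theorem inn_conj_symm (v w : Vec) : star (inn v w) = inn w v := by
  simp only [inn, dotProduct, Fin.sum_univ_two, Pi.star_apply, star_add, star_mul', star_star]
  ring

/-- Resolution of the identity for an orthonormal basis of ℂ². -/
theorem inn_eq_sum_of_orthonormal {f : Fin 2 → Vec}
    (hf : ∀ i j, inn (f i) (f j) = if i = j then 1 else 0) (v w : Vec) :
    inn v w = ∑ k, inn v (f k) * inn (f k) w := by
  let U : Mat := Matrix.of fun i j => star (f i j)
  have hU : U * Uᴴ = 1 := by
    ext i j
    simpa [U, Matrix.mul_apply, Matrix.one_apply, inn, dotProduct] using hf i j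
  have hU' : Uᴴ * U = 1 := mul_eq_one_comm.mp hU
  calc inn v w = star v ⬝ᵥ ((Uᴴ * U) *ᵥ w) := by rw [hU', Matrix.one_mulVec]; rfl
    _ = ∑ k, inn v (f k) * inn (f k) w := by
      simp only [U, inn, dotProduct, Matrix.mulVec, Matrix.mul_apply, Fin.sum_univ_two,
        Matrix.conjTranspose_apply, Matrix.of_apply, star_star, Pi.star_apply]
      ring

/-- A unit vector orthogonal to a vector of the first basis is unbiased for the second one. -/
theorem normSq_inn_eq_half_of_orthogonal {e : Fin 2 → Fin 2 → Vec} (he : IsMUBPair e)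
    {ψ : Vec} (hψ : inn ψ ψ = 1) {i : Fin 2} (hi : inn (e 0 i) ψ = 0) (b : Fin 2) :
    Complex.normSq (inn (e 1 b) ψ) = 1 / 2 := by
  have key : ∃ j, ∀ v, inn v ψ = inn v (e 0 j) * inn (e 0 j) ψ := by
    refine ⟨1 - i, fun v => ?_⟩
    rw [inn_eq_sum_of_orthonormal (he.1 0) v ψ, Fin.sum_univ_two]
    fin_cases i <;> simp_all
  obtain ⟨j, hj⟩ := key
  have hnorm : Complex.normSq (inn (e 0 j) ψ) = 1 := by
    have h := hj ψ
    rw [hψ, ← inn_conj_symm (e 0 j) ψ, mul_comm] at h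
    exact_mod_cast (Complex.mul_conj (inn (e 0 j) ψ)).symm.trans h.symm
  have hswap : Complex.normSq (inn (e 1 b) (e 0 j)) = 1 / 2 := by
    rw [← inn_conj_symm (e 0 j), ← he.2 j b]
    exact Complex.normSq_conj _
  rw [hj, Complex.normSq_mul, hnorm, hswap, mul_one]

/-- For any `0 < V ≤ 1`, the colored-noise BB84 family admits no extremal LHV-LHS model,
for every MUB pair on the qubit. -/
theorem colored_bb84_no_extremal_LHVLHS (V : ℝ) (hV1 : 0 < V) (hV2 : V ≤ 1)
    (e : Fin 2 → Fin 2 → Vec) (he : IsMUBPair e) :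
    ¬ HasExtremalLHVLHS e (Pcol V) := by
  rintro ⟨n, p, A, ψ, hp, -, hψ, hP⟩
  have vanish : ∀ a b, a ≠ b → ∀ l, A 0 l = a →
      p l * Complex.normSq (inn (e 0 b) (ψ l)) = 0 := by
    intro a b hab l hl
    have hzero : Pcol V a b 0 0 = 0 := by
      clear hl hP hψ
      fin_cases a <;> fin_cases b <;> first | exact absurd rfl hab | (simp [Pcol]; ring)
    rw [hP, Finset.sum_eq_zero_iff_of_nonneg fun k _ =>
      mul_nonneg (mul_nonneg (hp k) (by split_ifs <;> norm_num)) (Complex.normSq_nonneg _)] at hzero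
    simpa [hl] using hzero l (Finset.mem_univ l)
  have unbiased : ∀ l b, p l * Complex.normSq (inn (e 1 b) (ψ l)) = p l * (1 / 2) := by
    intro l b
    obtain ⟨c, hc⟩ : ∃ c, A 0 l ≠ c := (exists_ne (A 0 l)).imp fun _ => Ne.symm
    rcases mul_eq_zero.mp (vanish _ c hc l rfl) with h | h
    · simp [h]
    · rw [normSq_inn_eq_half_of_orthogonal he (hψ l) (Complex.normSq_eq_zero.mp h)]
  have hcorr : Pcol V 0 0 1 1 = Pcol V 0 1 1 1 := by
    rw [hP, hP]
    refine Finset.sum_congr rfl fun l _ => ?_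
    rw [mul_right_comm (p l) _ (Complex.normSq (inn (e 1 0) (ψ l))), unbiased,
      mul_right_comm (p l) _ (Complex.normSq (inn (e 1 1) (ψ l))), unbiased]
  simp [Pcol] at hcorr
  linarith
end
end

section
/- Let B₀ = {f₀,f₁}, B₁ = {g₀,g₁} be a MUB pair on the qubit and let q₀, q₁ ∈ [0,1]. There exists a unit vector ψ ∈ ℂ² with |⟨f₀, ψ⟩|² = q₀ and |⟨g₀, ψ⟩|² = q₁ if and only if (2q₀ − 1)² + (2q₁ − 1)² ≤ 1. -/
open Matrix Complex BigOperators
open scoped ComplexOrder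

noncomputable section

/-- Parseval's identity for an orthonormal basis of the qubit. -/
lemma inn_eq_add_of_orthonormal {f : Fin 2 → Vec}
    (hf : ∀ i j, inn (f i) (f j) = if i = j then 1 else 0) (v w : Vec) :
    inn v w = star (inn (f 0) v) * inn (f 0) w + star (inn (f 1) v) * inn (f 1) w := by
  have hF : (Matrix.of f).map star * (Matrix.of f)ᵀ = 1 := by
    ext i j
    have h := hf i j
    simp only [inn, dotProduct, Pi.star_apply] at h
    simpa [Matrix.mul_apply, Matrix.one_apply] using h
  have hF' := mul_eq_one_comm.mp hF
  have h (i j : Fin 2) := congrFun (congrFun hF' i) j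
  have h00 := h 0 0
  have h01 := h 0 1
  have h10 := h 1 0
  have h11 := h 1 1
  simp [Matrix.mul_apply, Fin.sum_univ_two] at h00 h01 h10 h11
  simp only [inn, dotProduct, Fin.sum_univ_two, Pi.star_apply, star_add, star_mul',
    RCLike.star_def] at *
  simp only [Complex.conj_conj]
  linear_combination (-(starRingEnd ℂ) (v 0) * w 0) * h00 - (starRingEnd ℂ) (v 0) * w 1 * h01
    - (starRingEnd ℂ) (v 1) * w 0 * h10 - (starRingEnd ℂ) (v 1) * w 1 * h11

lemma inn_add_smul (u v w : Vec) (α β : ℂ) :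
    inn u (α • v + β • w) = α * inn u v + β * inn u w := by
  simp [inn, dotProduct_add, dotProduct_smul]

/-- The necessary inequality, in the coordinates of the first basis. -/
lemma sq_add_sq_le_one_of_coordinates {a b α β : ℂ} (ha : normSq a = 1 / 2)
    (hb : normSq b = 1 / 2) (h : normSq α + normSq β = 1) :
    (2 * normSq α - 1) ^ 2 + (2 * normSq (star a * α + star b * β) - 1) ^ 2 ≤ 1 := by
  set z := star a * α * star (star b * β) with hz
  have hsum : normSq (star a * α + star b * β) = 1 / 2 + 2 * z.re := by
    rw [normSq_add]
    simp only [RCLike.star_def, normSq_mul, normSq_conj, ha, hb, hz]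
    linarith
  have hn : normSq z = normSq α * normSq β / 4 := by
    simp only [hz, RCLike.star_def, normSq_mul, normSq_conj, ha, hb]
    ring
  have hre : z.re ^ 2 ≤ normSq z := by
    rw [normSq_apply]
    nlinarith [mul_self_nonneg z.im]
  have hβ : normSq β = 1 - normSq α := by linarith
  rw [hn, hβ] at hre
  rw [hsum]
  nlinarith

/-- Two complex numbers of prescribed moduli whose sum has a prescribed modulus. -/
lemma exists_normSq_add_eq {q0 q1 : ℝ} (h0 : 0 ≤ q0) (h1 : q0 ≤ 1)
    (h : (2 * q0 - 1) ^ 2 + (2 * q1 - 1) ^ 2 ≤ 1) :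
    ∃ x y : ℂ, normSq x = q0 / 2 ∧ normSq y = (1 - q0) / 2 ∧ normSq (x + y) = q1 := by
  rcases h0.eq_or_lt with rfl | hpos
  · have hq : q1 = 1 / 2 := by nlinarith [sq_nonneg (2 * q1 - 1)]
    refine ⟨0, (√(1 / 2) : ℝ), by simp, ?_, ?_⟩
    · rw [normSq_ofReal, Real.mul_self_sqrt (by norm_num)]
      norm_num
    · rw [zero_add, normSq_ofReal, Real.mul_self_sqrt (by norm_num), hq]
  · set r := √(q0 / 2)
    have hr : r * r = q0 / 2 := Real.mul_self_sqrt (by positivity)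
    have hr0 : 0 < r := Real.sqrt_pos.mpr (by positivity)
    set c := (q1 - 1 / 2) / (2 * r) with hc
    have hrc : 2 * r * c = q1 - 1 / 2 := by rw [hc]; field_simp
    have hcc : 0 ≤ (1 - q0) / 2 - c * c := by
      have h2 : 2 * q0 * (c * c) = (q1 - 1 / 2) ^ 2 := by
        rw [← hrc]
        linear_combination (-4 * c * c) * hr
      have h3 : 0 ≤ q0 * ((1 - q0) / 2 - c * c) := by nlinarith
      exact nonneg_of_mul_nonneg_right h3 hpos
    have hd := Real.mul_self_sqrt hcc
    refine ⟨(r : ℂ), ⟨c, √((1 - q0) / 2 - c * c)⟩, ?_, ?_, ?_⟩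
    · rw [normSq_ofReal, hr]
    · rw [normSq_mk, hd]
      ring
    · simp only [normSq_apply, add_re, add_im, ofReal_re, ofReal_im, zero_add]
      linear_combination hr + hrc + hd

/-- A pair of target probabilities `(q₀, q₁)` for two MUB measurements arises from a
pure qubit state iff `(2q₀ − 1)² + (2q₁ − 1)² ≤ 1`. -/
theorem mub_pure_state_iff (e : Fin 2 → Fin 2 → Vec) (he : IsMUBPair e)
    (q0 q1 : ℝ) (hq0 : q0 ∈ Set.Icc (0 : ℝ) 1) (hq1 : q1 ∈ Set.Icc (0 : ℝ) 1) :
    (∃ ψ : Vec, inn ψ ψ = 1 ∧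
        Complex.normSq (inn (e 0 0) ψ) = q0 ∧
        Complex.normSq (inn (e 1 0) ψ) = q1) ↔
      (2 * q0 - 1) ^ 2 + (2 * q1 - 1) ^ 2 ≤ 1 := by
  obtain ⟨hon, hmub⟩ := he
  have parseval := inn_eq_add_of_orthonormal (hon 0)
  have norm_parseval (v : Vec) (hv : inn v v = 1) :
      normSq (inn (e 0 0) v) + normSq (inn (e 0 1) v) = 1 := by
    have h := parseval v v
    rw [hv] at h
    simp only [RCLike.star_def, ← normSq_eq_conj_mul_self] at h
    exact_mod_cast h.symm
  have ha := hmub 0 0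
  have hb := hmub 1 0
  constructor
  · rintro ⟨ψ, hψ, rfl, rfl⟩
    rw [parseval (e 1 0) ψ]
    exact sq_add_sq_le_one_of_coordinates ha hb (norm_parseval ψ hψ)
  · intro h
    obtain ⟨x, y, hx, hy, hxy⟩ := exists_normSq_add_eq hq0.1 hq0.2 h
    set a := inn (e 0 0) (e 1 0)
    set b := inn (e 0 1) (e 1 0)
    have h0 : inn (e 0 0) ((2 * a * x) • e 0 0 + (2 * b * y) • e 0 1) = 2 * a * x := by
      simp [inn_add_smul, hon]
    have h1 : inn (e 0 1) ((2 * a * x) • e 0 0 + (2 * b * y) • e 0 1) = 2 * b * y := by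
      simp [inn_add_smul, hon]
    have hα : normSq (2 * a * x) = q0 := by
      rw [normSq_mul, normSq_mul, ha, hx, normSq_ofNat]
      ring
    have hβ : normSq (2 * b * y) = 1 - q0 := by
      rw [normSq_mul, normSq_mul, hb, hy, normSq_ofNat]
      ring
    refine ⟨(2 * a * x) • e 0 0 + (2 * b * y) • e 0 1, ?_, ?_, ?_⟩
    · rw [parseval, h0, h1]
      simp only [RCLike.star_def, ← normSq_eq_conj_mul_self, hα, hβ]
      push_cast
      ring
    · rw [h0, hα]
    · rw [parseval, h0, h1, ← hxy]
      have ha' : star a * a = 1 / 2 := by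
        rw [RCLike.star_def, ← normSq_eq_conj_mul_self, ha]
        norm_num
      have hb' : star b * b = 1 / 2 := by
        rw [RCLike.star_def, ← normSq_eq_conj_mul_self, hb]
        norm_num
      congr 1
      linear_combination (2 * x) * ha' + (2 * y) * hb'
end
end

section
/- For every MUB pair on the qubit, the box P_US := (P_PR^{000} + P_PR^{110} + P_PR^{010} + P_PR^{100})/4 admits an extremal LHV-LHS model; in particular, it is unsteerable in the scenario where Bob measures in the two mutually unbiased bases. -/
open Matrix Complex BigOperators
open scoped ComplexOrder

noncomputable section

/-- The PR boxes `P_PR^{αβγ}`. -/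
def PPR (α β γ : Fin 2) (a b x y : Fin 2) : ℝ :=
  if a + b = x * y + α * x + β * y + γ then 1 / 2 else 0

/-- A box is unsteerable: it admits a LHV-LHS model. -/
def Unsteerable (e : Fin 2 → Fin 2 → Vec)
    (P : Fin 2 → Fin 2 → Fin 2 → Fin 2 → ℝ) : Prop :=
  ∃ (n : ℕ) (p : Fin n → ℝ) (q : Fin 2 → Fin 2 → Fin n → ℝ) (ρ : Fin n → Mat),
    (∀ l, 0 ≤ p l) ∧ (∑ l, p l = 1) ∧
    (∀ a x l, 0 ≤ q a x l) ∧ (∀ x l, ∑ a, q a x l = 1) ∧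
    (∀ l, (ρ l).PosSemidef) ∧ (∀ l, (ρ l).trace = 1) ∧
    (∀ a b x y, P a b x y =
      ∑ l, p l * q a x l * (star (e y b) ⬝ᵥ (ρ l).mulVec (e y b)).re)

theorem dotProduct_vecMulVec_mulVec (v w : Vec) :
    star v ⬝ᵥ (vecMulVec w (star w)).mulVec v = (Complex.normSq (inn v w) : ℂ) := by
  rw [Complex.normSq_eq_conj_mul_self, starRingEnd_apply, inn_conj_symm]
  simp only [inn, vecMulVec, mulVec, dotProduct, Fin.sum_univ_two, Matrix.of_apply,
    Pi.star_apply]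
  ring

theorem trace_vecMulVec_star (w : Vec) : (vecMulVec w (star w)).trace = inn w w := by
  rw [Matrix.trace_vecMulVec, inn, dotProduct_comm]

/-- Deterministic responses and pure states are a special case of a LHV-LHS model. -/
theorem HasExtremalLHVLHS.unsteerable {e : Fin 2 → Fin 2 → Vec}
    {P : Fin 2 → Fin 2 → Fin 2 → Fin 2 → ℝ} (h : HasExtremalLHVLHS e P) :
    Unsteerable e P := by
  obtain ⟨n, p, A, ψ, hp, hsum, hψ, hP⟩ := h
  refine ⟨n, p, fun a x l => if a = A x l then 1 else 0,
    fun l => vecMulVec (ψ l) (star (ψ l)), hp, hsum, fun a x l => ?_, fun x l => ?_,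
    fun l => posSemidef_vecMulVec_self_star (ψ l),
    fun l => (trace_vecMulVec_star (ψ l)).trans (hψ l), fun a b x y => ?_⟩
  · positivity
  · simp
  · simp only [hP, dotProduct_vecMulVec_mulVec, Complex.ofReal_re]

/-- The model: Alice's two outputs are independent uniform bits, and Bob holds the vector of the
first basis labelled by Alice's output for `x = 0`. -/
theorem hasExtremalLHVLHS_average_PPR {e : Fin 2 → Fin 2 → Vec} (he : IsMUBPair e) :
    HasExtremalLHVLHS e (fun a b x y =>
      (PPR 0 0 0 a b x y + PPR 1 1 0 a b x y +
       PPR 0 1 0 a b x y + PPR 1 0 0 a b x y) / 4) := by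
  obtain ⟨horth, hunb⟩ := he
  have hunb' (i j) : Complex.normSq (inn (e 1 i) (e 0 j)) = 1 / 2 := by
    rw [← inn_conj_symm, ← starRingEnd_apply, Complex.normSq_conj, hunb]
  refine ⟨4, fun _ => 1 / 4, ![![0, 0, 1, 1], ![0, 1, 0, 1]],
    fun l => e 0 (![0, 0, 1, 1] l), fun _ => by norm_num, by norm_num,
    fun l => by simp [horth], fun a b x y => ?_⟩
  fin_cases y
  · fin_cases a <;> fin_cases b <;> fin_cases x <;>
      simp [PPR, Fin.sum_univ_four, horth] <;> norm_num
  · fin_cases a <;> fin_cases b <;> fin_cases x <;>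
      simp [PPR, Fin.sum_univ_four, hunb'] <;> norm_num

/-- The box `(P_PR^{000} + P_PR^{110} + P_PR^{010} + P_PR^{100})/4` admits an extremal
LHV-LHS model for every MUB pair; in particular it is unsteerable. -/
theorem PUS_extremal_LHVLHS (e : Fin 2 → Fin 2 → Vec) (he : IsMUBPair e) :
    HasExtremalLHVLHS e (fun a b x y =>
      (PPR 0 0 0 a b x y + PPR 1 1 0 a b x y +
       PPR 0 1 0 a b x y + PPR 1 0 0 a b x y) / 4) ∧
    Unsteerable e (fun a b x y =>
      (PPR 0 0 0 a b x y + PPR 1 1 0 a b x y +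
       PPR 0 1 0 a b x y + PPR 1 0 0 a b x y) / 4) :=
  ⟨hasExtremalLHVLHS_average_PPR he, (hasExtremalLHVLHS_average_PPR he).unsteerable⟩
end
end
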